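/- Let λ ∈ ℝ, let I ⊆ ℝ be an open interval, and let q, p : (0,∞) × I → ℝ satisfy all the hypotheses of the two preceding results: for each ν ∈ I, (q,p) solve the Hamiltonian system in t with H(t,ν) := (t/2)·sinh²(q(t,ν)) − p(t,ν)²/(2t) + 4ν·sinh²(q(t,ν)/2); H, sinh²(q/2), and p·∂q/∂s − H are absolutely integrable on (t,∞) for every t > 0; t·H(t,ν) → 0 and p(t,ν)·∂q/∂ν(t,ν) → 0 as t → +∞; q and p are ν-differentiable with equal mixed partials of q; and the ν-derivative of S(t,ν) := ∫ₜ^∞ (p·∂q/∂s − H) ds may be taken under the integral sign. Then for all t > 0 and ν ∈ I the generalized tau-function τ(t;ν) := exp[(1/2)·∫ₜ^∞ H(s,ν) ds − ν·∫ₜ^∞ sinh²(q(s,ν)/2) ds]·cosh(q(t,ν)/2) satisfies the exact identity τ(t;ν) = exp[−(t/2)·H(t,ν) + (1/2)·S(t,ν) − (ν/4)·(p(t,ν)·(∂q/∂ν)(t,ν) + (∂S/∂ν)(t,ν))]·cosh(q(t,ν)/2). -/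

import Mathlib

/- STATEMENT 4 (identity (2.5)): the generalized tau-function expressed entirely
through boundary data of the Hamiltonian and action integrals. -/

/-- The Hamiltonian `H(q,p,t,ν)` evaluated along a family of solutions `(q,p)`
depending on the parameter ν (second argument). -/
noncomputable def Ham2 (q p : ℝ → ℝ → ℝ) (t ν : ℝ) : ℝ :=
  t/2 * Real.sinh (q t ν) ^ 2 - (p t ν) ^ 2 / (2 * t) + 4 * ν * Real.sinh (q t ν / 2) ^ 2

open Real Set Filter Topology MeasureTheory

/-- Solutions of the Hamiltonian system. -/
def SolODE (q p : ℝ → ℝ) (ν : ℝ) : Prop :=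
  ∀ t > (0:ℝ), HasDerivAt q (-(p t) / t) t ∧
    HasDerivAt p (-(t/2) * Real.sinh (2 * q t) - 2 * ν * Real.sinh (q t)) t

lemma SolODE.neg {q p : ℝ → ℝ} {ν : ℝ} (h : SolODE q p ν) :
    SolODE (fun t => - q t) (fun t => - p t) ν := by
  intro t ht
  obtain ⟨h1, h2⟩ := h t ht
  refine ⟨?_, ?_⟩
  · convert! h1.neg using 1
    ring
  · convert! h2.neg using 1
    simp only [mul_neg, Real.sinh_neg]
    ring

lemma sol_max_bound {q p : ℝ → ℝ} {ν : ℝ} (h : SolODE q p ν) {a b N M : ℝ} (ha : 0 < a)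
    (hab : a ≤ b) (hN : |ν| ≤ N) (hM : 2 * N / a ≤ M) (hqa : q a ≤ M) (hqb : q b ≤ M) :
    ∀ s ∈ Icc a b, q s ≤ M := by
  have hcont : ContinuousOn q (Icc a b) := fun s hs =>
    (h s (lt_of_lt_of_le ha hs.1)).1.continuousAt.continuousWithinAt
  obtain ⟨c, hc, hmax⟩ := isCompact_Icc.exists_isMaxOn (nonempty_Icc.2 hab) hcont
  intro s hs
  refine le_trans (hmax hs) ?_
  by_contra! hlt
  have hca : a < c := lt_of_le_of_ne hc.1 (by rintro rfl; linarith)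
  have hcb : c < b := lt_of_le_of_ne hc.2 (by rintro rfl; linarith)
  have hc0 : 0 < c := ha.trans hca
  have hN0 : 0 ≤ N := (abs_nonneg _).trans hN
  have hM0 : 0 ≤ M := le_trans (by positivity) hM
  obtain ⟨h1, h2⟩ := h c hc0
  have hloc : IsLocalMax q c := hmax.isLocalMax (Icc_mem_nhds hca hcb)
  have hz := hloc.hasDerivAt_eq_zero h1
  have hpc : p c = 0 := by
    field_simp at hz
    linarith
  have hneg : -(c/2) * Real.sinh (2 * q c) - 2 * ν * Real.sinh (q c) < 0 := by
    have e : -(c/2) * Real.sinh (2 * q c) - 2 * ν * Real.sinh (q c)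
        = - (Real.sinh (q c) * (c * Real.cosh (q c) + 2 * ν)) := by
      rw [Real.sinh_two_mul]; ring
    rw [e, neg_lt_zero]
    have hq0 : 0 < q c := by linarith
    have hs0 : 0 < Real.sinh (q c) := Real.sinh_pos_iff.2 hq0
    have hcs : q c < Real.cosh (q c) :=
      lt_of_le_of_lt (Real.self_le_sinh_iff.2 hq0.le) (Real.sinh_lt_cosh _)
    apply mul_pos hs0
    have h3 : 2 * N ≤ a * M := by
      rw [div_le_iff₀ ha] at hM; linarith
    have h4 : a * M < c * Real.cosh (q c) :=
      mul_lt_mul hca (by linarith) (by linarith) hc0.le |>.trans_le' (by nlinarith) 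
    have := neg_abs_le ν
    linarith
  have hev : ∀ᶠ x in 𝓝[≠] c, slope p c x < 0 :=
    (hasDerivAt_iff_tendsto_slope.1 h2).eventually (gt_mem_nhds hneg)
  rw [eventually_nhdsWithin_iff, Metric.eventually_nhds_iff] at hev
  obtain ⟨ε, hε, hev⟩ := hev
  set d := min (c + ε/2) b with hd
  have hcd : c < d := lt_min (by linarith) hcb
  obtain ⟨x, hx, hx'⟩ := exists_hasDerivAt_eq_slope q (fun t => -(p t)/t) hcd
    (fun y hy => (h y (by linarith [hy.1])).1.continuousAt.continuousWithinAt)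
    (fun y hy => (h y (by linarith [hy.1])).1)
  have hxε : x < c + ε/2 := hx.2.trans_le (min_le_left _ _)
  have hsl := @hev x (by rw [Real.dist_eq, abs_of_pos] <;> linarith [hx.1]) (ne_of_gt hx.1)
  rw [slope_def_field, hpc, sub_zero, div_neg_iff] at hsl
  have hpx : p x < 0 := by
    rcases hsl with h | h
    · linarith [hx.1, h.2]
    · exact h.1
  have hpos : 0 < -(p x) / x := div_pos (by linarith) (by linarith [hx.1])
  have hmd : q d ≤ q c := hmax ⟨by linarith, min_le_right _ _⟩
  have : (q d - q c) / (d - c) ≤ 0 := div_nonpos_of_nonpos_of_nonneg (by linarith) (by linarith)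
  linarith

lemma sol_abs_bound {q p : ℝ → ℝ} {ν : ℝ} (h : SolODE q p ν) {a b N M : ℝ} (ha : 0 < a)
    (hab : a ≤ b) (hN : |ν| ≤ N) (hM : 2 * N / a ≤ M) (hqa : |q a| ≤ M) (hqb : |q b| ≤ M) :
    ∀ s ∈ Icc a b, |q s| ≤ M := by
  intro s hs
  rw [abs_le] at *
  refine ⟨?_, sol_max_bound h ha hab (abs_le.2 hN) hM hqa.2 hqb.2 s hs⟩
  have := sol_max_bound h.neg ha hab (abs_le.2 hN) hM (by linarith [hqa.1]) (by linarith [hqb.1]) s hs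
  linarith

lemma sinh_lip {M x y : ℝ} (hx : |x| ≤ M) (hy : |y| ≤ M) :
    |Real.sinh x - Real.sinh y| ≤ Real.cosh M * |x - y| := by
  have := (convex_Icc (-M) M).norm_image_sub_le_of_norm_hasDerivWithin_le (f := Real.sinh)
    (f' := Real.cosh) (C := Real.cosh M) (x := y) (y := x)
    (fun z _ => (Real.hasDerivAt_sinh z).hasDerivWithinAt)
    (fun z hz => by
      rw [Real.norm_eq_abs, abs_of_pos (Real.cosh_pos _), Real.cosh_le_cosh]
      exact (abs_le.2 ⟨hz.1, hz.2⟩).trans (le_abs_self M))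
    (abs_le.1 hy) (abs_le.1 hx)
  simpa [Real.norm_eq_abs] using this

lemma sinh_bdd {M x : ℝ} (hx : |x| ≤ M) : |Real.sinh x| ≤ Real.sinh M := by
  rw [Real.abs_sinh]; exact Real.sinh_le_sinh.2 hx

lemma sol_gronwall {a b N M : ℝ} (ha : 0 < a) (hab : a ≤ b) (hN0 : 0 ≤ N) (hM0 : 0 ≤ M) :
    ∃ C : ℝ, 0 ≤ C ∧ ∀ (ν ν' : ℝ) (q p q' p' : ℝ → ℝ), SolODE q p ν → SolODE q' p' ν' →
      |ν| ≤ N → (∀ s ∈ Icc a b, |q s| ≤ M) → (∀ s ∈ Icc a b, |q' s| ≤ M) →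
      ∀ s ∈ Icc a b, max |q s - q' s| |p s - p' s|
        ≤ C * (max |q a - q' a| |p a - p' a| + |ν - ν'|) := by
  set K : ℝ := 1/a + b * Real.cosh (2*M) + 2 * N * Real.cosh M with hK
  have hb : 0 < b := ha.trans_le hab
  have c1 := Real.cosh_pos (2*M)
  have c2 := Real.cosh_pos M
  have hKpos : 0 < K := by positivity
  have hsM : 0 ≤ Real.sinh M := Real.sinh_nonneg_iff.2 hM0
  refine ⟨(1 + 2 * Real.sinh M / K) * Real.exp (K * (b - a)), by positivity, ?_⟩
  intro ν ν' q p q' p' h h' hν hq hq' s hs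
  have key := dist_le_of_approx_trajectories_ODE_of_mem (E := ℝ × ℝ) (a := a) (b := b)
    (K := K.toNNReal) (v := fun t z => (-z.2/t, -(t/2) * Real.sinh (2 * z.1) - 2 * ν * Real.sinh z.1))
    (s := fun _ => {z | |z.1| ≤ M})
    (f := fun t => (q t, p t)) (g := fun t => (q' t, p' t))
    (f' := fun t => (-(p t)/t, -(t/2) * Real.sinh (2 * q t) - 2 * ν * Real.sinh (q t)))
    (g' := fun t => (-(p' t)/t, -(t/2) * Real.sinh (2 * q' t) - 2 * ν' * Real.sinh (q' t)))
    (εf := 0) (εg := 2 * |ν - ν'| * Real.sinh M) (δ := max |q a - q' a| |p a - p' a|)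
    (by
      intro t ht
      have ht0 : 0 < t := ha.trans_le ht.1
      apply LipschitzOnWith.of_dist_le_mul
      rintro ⟨x, y⟩ hx ⟨x', y'⟩ hx'
      simp only [mem_ofPred_eq] at hx hx'
      rw [Real.coe_toNNReal _ hKpos.le]
      simp only [Prod.dist_eq, Real.dist_eq]
      set D := max |x - x'| |y - y'| with hD
      have hD1 : |x - x'| ≤ D := le_max_left _ _
      have hD2 : |y - y'| ≤ D := le_max_right _ _
      have hD0 : 0 ≤ D := (abs_nonneg _).trans hD1
      apply max_le
      · have e : -y/t - -y'/t = -((y - y')/t) := by ring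
        rw [e, abs_neg, abs_div, abs_of_pos ht0]
        calc |y - y'| / t ≤ D / a := by gcongr; exact ht.1
          _ = 1/a * D := by ring
          _ ≤ K * D := by
            gcongr
            rw [hK]
            have : 0 ≤ b * Real.cosh (2*M) := by positivity
            have : 0 ≤ 2 * N * Real.cosh M := by positivity
            linarith
      · have e : -(t/2) * Real.sinh (2 * x) - 2 * ν * Real.sinh x
            - (-(t/2) * Real.sinh (2 * x') - 2 * ν * Real.sinh x')
            = -((t/2) * (Real.sinh (2*x) - Real.sinh (2*x'))
              + 2 * ν * (Real.sinh x - Real.sinh x')) := by ring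
        rw [e, abs_neg]
        have l1 : |Real.sinh (2*x) - Real.sinh (2*x')| ≤ Real.cosh (2*M) * (2 * D) := by
          refine (sinh_lip (M := 2*M) (by rw [abs_mul, abs_two]; linarith)
            (by rw [abs_mul, abs_two]; linarith)).trans ?_
          rw [← mul_sub, abs_mul, abs_two]
          gcongr
        have l2 : |Real.sinh x - Real.sinh x'| ≤ Real.cosh M * D :=
          (sinh_lip hx hx').trans (by gcongr)
        calc _ ≤ |(t/2) * (Real.sinh (2*x) - Real.sinh (2*x'))|
              + |2 * ν * (Real.sinh x - Real.sinh x')| := abs_add_le _ _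
          _ = t/2 * |Real.sinh (2*x) - Real.sinh (2*x')|
              + 2 * |ν| * |Real.sinh x - Real.sinh x'| := by
            rw [abs_mul, abs_mul, abs_mul, abs_two, abs_of_pos (half_pos ht0)]
          _ ≤ b/2 * (Real.cosh (2*M) * (2 * D)) + 2 * N * (Real.cosh M * D) := by
            gcongr
            exact ht.2.le
          _ = (b * Real.cosh (2*M) + 2 * N * Real.cosh M) * D := by ring
          _ ≤ K * D := by
            gcongr
            have : 0 < 1/a := by positivity
            linarith)
    (fun t ht => (((h t (ha.trans_le ht.1)).1.continuousAt).prodMk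
      ((h t (ha.trans_le ht.1)).2.continuousAt)).continuousWithinAt)
    (fun t ht => ((h t (ha.trans_le ht.1)).1.prodMk (h t (ha.trans_le ht.1)).2).hasDerivWithinAt)
    (fun t ht => by simp)
    (fun t ht => hq t ⟨ht.1, ht.2.le⟩)
    (fun t ht => (((h' t (ha.trans_le ht.1)).1.continuousAt).prodMk
      ((h' t (ha.trans_le ht.1)).2.continuousAt)).continuousWithinAt)
    (fun t ht => ((h' t (ha.trans_le ht.1)).1.prodMk (h' t (ha.trans_le ht.1)).2).hasDerivWithinAt)
    (fun t ht => by
      simp only [Prod.dist_eq, Real.dist_eq, sub_self, abs_zero]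
      apply max_le (by positivity)
      have e : -(t/2) * Real.sinh (2 * q' t) - 2 * ν' * Real.sinh (q' t)
        - (-(t/2) * Real.sinh (2 * q' t) - 2 * ν * Real.sinh (q' t))
        = 2 * (ν - ν') * Real.sinh (q' t) := by ring
      rw [e, abs_mul, abs_mul, abs_two]
      gcongr
      exact sinh_bdd (hq' t ⟨ht.1, ht.2.le⟩))
    (fun t ht => hq' t ⟨ht.1, ht.2.le⟩)
    (by simp [Prod.dist_eq, Real.dist_eq]) s hs
  simp only [Prod.dist_eq, Real.dist_eq] at key
  refine key.trans ?_
  rw [Real.coe_toNNReal _ hKpos.le, gronwallBound_of_K_ne_0 hKpos.ne', zero_add]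
  set δ := max |q a - q' a| |p a - p' a|
  have hδ0 : 0 ≤ δ := (abs_nonneg _).trans (le_max_left _ _)
  have hE : Real.exp (K * (s - a)) ≤ Real.exp (K * (b - a)) :=
    Real.exp_le_exp.2 (by gcongr; exact hs.2)
  set E := Real.exp (K * (b - a))
  have hE0 : 0 < E := Real.exp_pos _
  calc δ * Real.exp (K * (s - a)) + 2 * |ν - ν'| * Real.sinh M / K * (Real.exp (K * (s - a)) - 1)
      ≤ δ * E + 2 * |ν - ν'| * Real.sinh M / K * E := by
        gcongr
        linarith
    _ ≤ (1 + 2 * Real.sinh M / K) * E * (δ + |ν - ν'|) := by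
        have : 0 ≤ 2 * Real.sinh M / K * E * δ + E * |ν - ν'| := by positivity
        have e : 2 * |ν - ν'| * Real.sinh M / K * E = 2 * Real.sinh M / K * E * |ν - ν'| := by ring
        rw [e]
        linarith

/-- Uniform pointwise-Lipschitz bound in the parameter at `ν₀`, for times in `[a,b]`. -/
def UL (a b ν₀ : ℝ) (F : ℝ → ℝ → ℝ) : Prop :=
  ∃ C : ℝ, 0 ≤ C ∧ ∀ᶠ ν in 𝓝 ν₀, ∀ s ∈ Icc a b, |F s ν| ≤ C ∧ |F s ν - F s ν₀| ≤ C * |ν - ν₀|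

lemma UL.mono {a b c d ν₀ : ℝ} {F : ℝ → ℝ → ℝ} (h : UL a b ν₀ F) (hs : Icc c d ⊆ Icc a b) :
    UL c d ν₀ F := by
  obtain ⟨C, hC, h⟩ := h
  exact ⟨C, hC, h.mono fun ν hν s hs' => hν s (hs hs')⟩

lemma UL.congr {a b ν₀ : ℝ} {F G : ℝ → ℝ → ℝ} (h : UL a b ν₀ F)
    (hFG : ∀ᶠ ν in 𝓝 ν₀, ∀ s ∈ Icc a b, F s ν = G s ν) : UL a b ν₀ G := by
  obtain ⟨C, hC, h⟩ := h
  refine ⟨C, hC, ?_⟩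
  filter_upwards [h, hFG] with ν hν h2 s hs
  rw [← h2 s hs, ← hFG.self_of_nhds s hs]
  exact hν s hs

lemma UL.of_lip {a b ν₀ C : ℝ} {F : ℝ → ℝ → ℝ} (hc : ContinuousOn (fun s => F s ν₀) (Icc a b))
    (h : ∀ᶠ ν in 𝓝 ν₀, ∀ s ∈ Icc a b, |F s ν - F s ν₀| ≤ C * |ν - ν₀|) : UL a b ν₀ F := by
  obtain ⟨P, hP⟩ := isCompact_Icc.exists_bound_of_continuousOn hc
  refine ⟨|P| + |C|, by positivity, ?_⟩
  filter_upwards [h, Metric.ball_mem_nhds ν₀ one_pos] with ν hν hb s hs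
  rw [Metric.mem_ball, Real.dist_eq] at hb
  have h1 := hν s hs
  have h2 := hP s hs
  rw [Real.norm_eq_abs] at h2
  have h3 : C * |ν - ν₀| ≤ |C| * |ν - ν₀| := by gcongr; exact le_abs_self C
  have h4 : |C| * |ν - ν₀| ≤ |C| * 1 := by gcongr
  have h5 : |F s ν| ≤ |F s ν₀| + |F s ν - F s ν₀| := by
    have := abs_add_le (F s ν₀) (F s ν - F s ν₀)
    simpa using this
  have h6 := le_abs_self P
  have h7 : 0 ≤ |P| * |ν - ν₀| := by positivity
  constructor
  · linarith
  · rw [add_mul]; linarith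

lemma UL.time {a b ν₀ : ℝ} {f : ℝ → ℝ} (hc : ContinuousOn f (Icc a b)) :
    UL a b ν₀ (fun s _ => f s) :=
  UL.of_lip (C := 0) hc (Eventually.of_forall fun ν s _ => by simp)

lemma UL.param {a b ν₀ : ℝ} : UL a b ν₀ (fun _ ν => ν) :=
  UL.of_lip (C := 1) continuousOn_const (Eventually.of_forall fun ν s _ => by simp)

lemma UL.add {a b ν₀ : ℝ} {F G : ℝ → ℝ → ℝ} (hF : UL a b ν₀ F) (hG : UL a b ν₀ G) :
    UL a b ν₀ (fun s ν => F s ν + G s ν) := by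
  obtain ⟨C, hC, hF⟩ := hF
  obtain ⟨D, hD, hG⟩ := hG
  refine ⟨C + D, by positivity, ?_⟩
  filter_upwards [hF, hG] with ν h1 h2 s hs
  obtain ⟨a1, a2⟩ := h1 s hs
  obtain ⟨b1, b2⟩ := h2 s hs
  constructor
  · exact (abs_add_le _ _).trans (by linarith)
  · have e : F s ν + G s ν - (F s ν₀ + G s ν₀) = (F s ν - F s ν₀) + (G s ν - G s ν₀) := by ring
    rw [e, add_mul]
    exact (abs_add_le _ _).trans (by linarith)

lemma UL.mul {a b ν₀ : ℝ} {F G : ℝ → ℝ → ℝ} (hF : UL a b ν₀ F) (hG : UL a b ν₀ G) :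
    UL a b ν₀ (fun s ν => F s ν * G s ν) := by
  obtain ⟨C, hC, hF⟩ := hF
  obtain ⟨D, hD, hG⟩ := hG
  refine ⟨2 * (C * D), by positivity, ?_⟩
  have hF0 := hF.self_of_nhds
  filter_upwards [hF, hG] with ν h1 h2 s hs
  obtain ⟨a1, a2⟩ := h1 s hs
  obtain ⟨b1, b2⟩ := h2 s hs
  have a0 := (hF0 s hs).1
  constructor
  · rw [abs_mul]
    have : |F s ν| * |G s ν| ≤ C * D := by gcongr
    nlinarith [mul_nonneg hC hD]
  · have e : F s ν * G s ν - F s ν₀ * G s ν₀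
      = (F s ν - F s ν₀) * G s ν + F s ν₀ * (G s ν - G s ν₀) := by ring
    rw [e]
    refine (abs_add_le _ _).trans ?_
    rw [abs_mul, abs_mul]
    calc _ ≤ (C * |ν - ν₀|) * D + C * (D * |ν - ν₀|) := by gcongr
      _ = _ := by ring

lemma UL.sinh {a b ν₀ : ℝ} {F : ℝ → ℝ → ℝ} (hF : UL a b ν₀ F) :
    UL a b ν₀ (fun s ν => Real.sinh (F s ν)) := by
  obtain ⟨C, hC, hF⟩ := hF
  have hc := Real.cosh_pos C
  have hs := Real.sinh_nonneg_iff.2 hC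
  refine ⟨Real.sinh C + Real.cosh C * C, by positivity, ?_⟩
  have hF0 := hF.self_of_nhds
  filter_upwards [hF] with ν h1 s hs'
  obtain ⟨a1, a2⟩ := h1 s hs'
  have a0 := (hF0 s hs').1
  constructor
  · have := sinh_bdd a1
    have : 0 ≤ Real.cosh C * C := by positivity
    linarith
  · refine (sinh_lip a1 a0).trans ?_
    calc _ ≤ Real.cosh C * (C * |ν - ν₀|) := by gcongr
      _ = (Real.cosh C * C) * |ν - ν₀| := by ring
      _ ≤ _ := by gcongr; linarith

lemma UL.hasDerivAt_integral {a b ν₀ : ℝ} (hab : a ≤ b) {F : ℝ → ℝ → ℝ} {F' : ℝ → ℝ}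
    (hF : UL a b ν₀ F)
    (hc : ∀ᶠ ν in 𝓝 ν₀, ContinuousOn (fun s => F s ν) (Icc a b))
    (hd : ∀ s ∈ Icc a b, HasDerivAt (fun ν => F s ν) (F' s) ν₀) :
    IntervalIntegrable F' volume a b ∧
      HasDerivAt (fun ν => ∫ s in a..b, F s ν) (∫ s in a..b, F' s) ν₀ := by
  obtain ⟨C, hC, hF⟩ := hF
  have hmeas : ∀ᶠ ν in 𝓝 ν₀, AEStronglyMeasurable (fun s => F s ν) (volume.restrict (Ioc a b)) :=
    hc.mono fun ν h => (h.mono Ioc_subset_Icc_self).aestronglyMeasurable measurableSet_Ioc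
  have hF'meas : AEStronglyMeasurable F' (volume.restrict (Ioc a b)) := by
    have hu : Tendsto (fun n : ℕ => ν₀ + 1 / ((n : ℝ) + 1)) atTop (𝓝[≠] ν₀) := by
      rw [tendsto_nhdsWithin_iff]
      constructor
      · simpa using tendsto_one_div_add_atTop_nhds_zero_nat (𝕜 := ℝ) |>.const_add ν₀
      · refine Eventually.of_forall fun n => ?_
        have : (0:ℝ) < 1 / ((n : ℝ) + 1) := by positivity
        simp only [mem_compl_iff, mem_singleton_iff]
        intro h
        linarith
    obtain ⟨n0, hn0⟩ := eventually_atTop.1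
      ((hu.mono_right nhdsWithin_le_nhds).eventually hmeas)
    refine aestronglyMeasurable_of_tendsto_ae (u := atTop)
      (f := fun (n : ℕ) s => slope (fun ν => F s ν) ν₀ (ν₀ + 1 / (((n + n0 : ℕ) : ℝ) + 1))) ?_ ?_
    · intro n
      simp only [slope_def_field, div_eq_mul_inv]
      have h := (hn0 (n + n0) (Nat.le_add_left _ _)).sub hmeas.self_of_nhds
      simp only [div_eq_mul_inv] at h
      exact AEStronglyMeasurable.mul h aestronglyMeasurable_const
    · refine (ae_restrict_iff' measurableSet_Ioc).2 (Eventually.of_forall fun s hs => ?_)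
      exact (hasDerivAt_iff_tendsto_slope.1 (hd s (Ioc_subset_Icc_self hs))).comp
        (hu.comp (tendsto_add_atTop_nat n0))
  have hsets := hmeas.and hF
  have main := hasFDerivAt_integral_of_dominated_loc_of_lip' (𝕜 := ℝ)
    (μ := volume.restrict (Ioc a b)) (F := fun ν s => F s ν) (x₀ := ν₀)
    (F' := fun s => ContinuousLinearMap.toSpanSingleton ℝ (F' s)) (bound := fun _ => C)
    hsets (fun x hx => hx.1)
    (((hc.self_of_nhds).integrableOn_Icc).mono_set Ioc_subset_Icc_self)
    ((ContinuousLinearMap.toSpanSingletonCLE (𝕜 := ℝ) (E := ℝ)).continuous.comp_aestronglyMeasurable hF'meas)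
    ((ae_restrict_iff' measurableSet_Ioc).2 (Eventually.of_forall fun s hs x hx =>
      (hx.2 s (Ioc_subset_Icc_self hs)).2))
    (integrable_const C)
    ((ae_restrict_iff' measurableSet_Ioc).2 (Eventually.of_forall fun s hs =>
      (hd s (Ioc_subset_Icc_self hs)).hasFDerivAt))
  have hint : Integrable F' (volume.restrict (Ioc a b)) := by
    have := main.1.apply_continuousLinearMap (1 : ℝ)
    simpa using this
  refine ⟨(intervalIntegrable_iff_integrableOn_Ioc_of_le hab).2 hint, ?_⟩
  simp only [intervalIntegral.integral_of_le hab]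
  have h2 := main.2.hasDerivAt
  convert! h2 using 1
  rw [ContinuousLinearMap.integral_apply main.1]
  simp

/-- A family of solutions is uniformly Lipschitz at `ν₀`. -/
lemma sol_UL {q p : ℝ → ℝ → ℝ} {ν₀ a b : ℝ} (ha : 0 < a) (hab : a ≤ b)
    (hsol : ∀ᶠ ν in 𝓝 ν₀, SolODE (fun t => q t ν) (fun t => p t ν) ν)
    (hqa : DifferentiableAt ℝ (fun ν => q a ν) ν₀) (hqb : DifferentiableAt ℝ (fun ν => q b ν) ν₀)
    (hpa : DifferentiableAt ℝ (fun ν => p a ν) ν₀) :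
    UL a b ν₀ q ∧ UL a b ν₀ p := by
  set N : ℝ := |ν₀| + 1 with hN
  set M : ℝ := max (2 * N / a) (max (|q a ν₀| + 1) (|q b ν₀| + 1)) with hM
  have hN0 : 0 ≤ N := by positivity
  have hM1 : 2 * N / a ≤ M := le_max_left _ _
  have hM2 : |q a ν₀| + 1 ≤ M := (le_max_left _ _).trans (le_max_right _ _)
  have hM3 : |q b ν₀| + 1 ≤ M := (le_max_right _ _).trans (le_max_right _ _)
  have hM0 : 0 ≤ M := le_trans (by positivity) hM1
  obtain ⟨C, hC, hG⟩ := sol_gronwall (N := N) (M := M) ha hab hN0 hM0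
  have e1 : ∀ᶠ ν in 𝓝 ν₀, |ν| < |ν₀| + 1 :=
    (continuous_abs.tendsto ν₀).eventually (gt_mem_nhds (by linarith))
  have e2 : ∀ᶠ ν in 𝓝 ν₀, |q a ν| < |q a ν₀| + 1 :=
    (hqa.continuousAt.abs.tendsto).eventually (gt_mem_nhds (by linarith))
  have e3 : ∀ᶠ ν in 𝓝 ν₀, |q b ν| < |q b ν₀| + 1 :=
    (hqb.continuousAt.abs.tendsto).eventually (gt_mem_nhds (by linarith))
  obtain ⟨c1, h1⟩ := hqa.isBigO_sub.bound
  obtain ⟨c2, h2⟩ := hpa.isBigO_sub.bound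
  have hbd : ∀ᶠ ν in 𝓝 ν₀, ∀ s ∈ Icc a b, |q s ν| ≤ M := by
    filter_upwards [e1, e2, e3, hsol] with ν g1 g2 g3 g4
    exact sol_abs_bound g4 ha hab g1.le hM1 (by linarith) (by linarith)
  have hlip : ∀ᶠ ν in 𝓝 ν₀, ∀ s ∈ Icc a b, max |q s ν - q s ν₀| |p s ν - p s ν₀|
      ≤ (C * (|c1| + |c2| + 1)) * |ν - ν₀| := by
    filter_upwards [e1, hbd, hsol, h1, h2] with ν g1 g2 g3 g4 g5 s hs
    refine (hG ν ν₀ _ _ _ _ g3 hsol.self_of_nhds g1.le g2 hbd.self_of_nhds s hs).trans ?_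
    rw [mul_assoc]
    gcongr
    simp only [Real.norm_eq_abs] at g4 g5
    have k1 : c1 * |ν - ν₀| ≤ |c1| * |ν - ν₀| := by gcongr; exact le_abs_self _
    have k2 : c2 * |ν - ν₀| ≤ |c2| * |ν - ν₀| := by gcongr; exact le_abs_self _
    have k3 : 0 ≤ |c1| * |ν - ν₀| := by positivity
    have k4 : 0 ≤ |c2| * |ν - ν₀| := by positivity
    have : max |q a ν - q a ν₀| |p a ν - p a ν₀| ≤ (|c1| + |c2|) * |ν - ν₀| :=
      max_le (by linarith) (by linarith)
    linarith
  have h0 := hsol.self_of_nhds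
  exact ⟨UL.of_lip (fun s hs => (h0 s (ha.trans_le hs.1)).1.continuousAt.continuousWithinAt)
      (hlip.mono fun ν h s hs => (le_max_left _ _).trans (h s hs)),
    UL.of_lip (fun s hs => (h0 s (ha.trans_le hs.1)).2.continuousAt.continuousWithinAt)
      (hlip.mono fun ν h s hs => (le_max_right _ _).trans (h s hs))⟩

lemma deriv_primitive {a b ν₀ : ℝ} {y F : ℝ → ℝ → ℝ} {y' F' : ℝ → ℝ}
    (hF : UL a b ν₀ F)
    (hc : ∀ᶠ ν in 𝓝 ν₀, ContinuousOn (fun s => F s ν) (Icc a b))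
    (hd : ∀ s ∈ Icc a b, HasDerivAt (fun ν => F s ν) (F' s) ν₀)
    (hy : ∀ᶠ ν in 𝓝 ν₀, ∀ s ∈ Icc a b, HasDerivAt (fun s => y s ν) (F s ν) s)
    (hyd : ∀ s ∈ Icc a b, HasDerivAt (fun ν => y s ν) (y' s) ν₀) :
    ∀ x ∈ Icc a b, y' x = y' a + ∫ s in a..x, F' s := by
  intro x hx
  have hsub : Icc a x ⊆ Icc a b := Icc_subset_Icc_right hx.2
  obtain ⟨-, h2⟩ := (hF.mono hsub).hasDerivAt_integral hx.1 (hc.mono fun ν h => h.mono hsub)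
    (fun s hs => hd s (hsub hs))
  have h3 := (hyd a ⟨le_rfl, hx.1.trans hx.2⟩).add h2
  refine (hyd x hx).unique (h3.congr_of_eventuallyEq ?_)
  filter_upwards [hc, hy] with ν k1 k2
  have := intervalIntegral.integral_eq_sub_of_hasDerivAt (f := fun s => y s ν) (f' := fun s => F s ν)
    (a := a) (b := x) (fun s hs => k2 s (hsub (by rwa [uIcc_of_le hx.1] at hs)))
    ((k1.mono hsub).intervalIntegrable_of_Icc hx.1)
  simp only [Pi.add_apply]
  rw [this]; ring

lemma qnu_hasDerivAt {q p : ℝ → ℝ → ℝ} {qnu pnu : ℝ → ℝ} {ν₀ : ℝ}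
    (hsol : ∀ᶠ ν in 𝓝 ν₀, SolODE (fun t => q t ν) (fun t => p t ν) ν)
    (hq : ∀ t > (0:ℝ), HasDerivAt (fun ν => q t ν) (qnu t) ν₀)
    (hp : ∀ t > (0:ℝ), HasDerivAt (fun ν => p t ν) (pnu t) ν₀) :
    ∀ t > (0:ℝ), HasDerivAt qnu (-(pnu t) / t) t := by
  intro t ht
  set a := t / 2 with haa
  set b := t + 1 with hbb
  have ha : 0 < a := by positivity
  have hab : a ≤ b := by linarith
  have hpos : ∀ s ∈ Icc a b, 0 < s := fun s hs => ha.trans_le hs.1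
  obtain ⟨Uq, Up⟩ := sol_UL ha hab hsol (hq a ha).differentiableAt
    (hq b (by linarith)).differentiableAt (hp a ha).differentiableAt
  have cq : ∀ᶠ ν in 𝓝 ν₀, ContinuousOn (fun s => q s ν) (Icc a b) := hsol.mono fun ν h s hs =>
    (h s (hpos s hs)).1.continuousAt.continuousWithinAt
  have cp : ∀ᶠ ν in 𝓝 ν₀, ContinuousOn (fun s => p s ν) (Icc a b) := hsol.mono fun ν h s hs =>
    (h s (hpos s hs)).2.continuousAt.continuousWithinAt
  have UG : UL a b ν₀ (fun s ν => -(s/2) * Real.sinh (2 * q s ν) - 2 * ν * Real.sinh (q s ν)) := by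
    refine (((UL.time (f := fun s => -(s/2)) (by fun_prop)).mul
      (((UL.time (f := fun _ => 2) (by fun_prop)).mul Uq).sinh)).add
      (((UL.time (f := fun _ => -2) (by fun_prop)).mul UL.param).mul Uq.sinh)).congr ?_
    refine Eventually.of_forall fun ν s _ => ?_
    ring
  have cG : ∀ᶠ ν in 𝓝 ν₀, ContinuousOn
      (fun s => -(s/2) * Real.sinh (2 * q s ν) - 2 * ν * Real.sinh (q s ν)) (Icc a b) := by
    filter_upwards [cq] with ν h
    fun_prop
  have dG : ∀ s ∈ Icc a b, HasDerivAt
      (fun ν => -(s/2) * Real.sinh (2 * q s ν) - 2 * ν * Real.sinh (q s ν))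
      (-(s/2) * (Real.cosh (2 * q s ν₀) * (2 * qnu s))
        - (2 * 1 * Real.sinh (q s ν₀) + 2 * ν₀ * (Real.cosh (q s ν₀) * qnu s))) ν₀ := by
    intro s hs
    have h := hq s (hpos s hs)
    exact ((h.const_mul 2).sinh.const_mul _).sub (((hasDerivAt_id ν₀).const_mul 2).mul h.sinh)
  have IG := (UG.hasDerivAt_integral hab cG dG).1
  have eP := deriv_primitive UG cG dG (y := p) (y' := pnu)
    (hsol.mono fun ν h s hs => (h s (hpos s hs)).2) (fun s hs => hp s (hpos s hs))
  have cpnu : ContinuousOn pnu (Icc a b) := by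
    have := intervalIntegral.continuousOn_primitive_interval' IG left_mem_uIcc
    rw [uIcc_of_le hab] at this
    exact (this.const_add (pnu a) |>.congr eP)
  have UF : UL a b ν₀ (fun s ν => -(p s ν) / s) := by
    refine ((UL.time (f := fun s => -s⁻¹) ?_).mul Up).congr ?_
    · exact (continuousOn_inv₀.mono fun s hs => (hpos s hs).ne').neg
    · refine Eventually.of_forall fun ν s _ => ?_
      ring
  have eQ := deriv_primitive UF (F' := fun s => -(pnu s) / s) (y := q) (y' := qnu)
    (cp.mono fun ν h => h.neg.div continuousOn_id fun s hs => (hpos s hs).ne')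
    (fun s hs => (hp s (hpos s hs)).neg.div_const s)
    (hsol.mono fun ν h s hs => (h s (hpos s hs)).1) (fun s hs => hq s (hpos s hs))
  have cF : ContinuousOn (fun s => -(pnu s) / s) (Icc a b) :=
    cpnu.neg.div continuousOn_id fun s hs => (hpos s hs).ne'
  have hat : a < t := by linarith
  have htb : t < b := by linarith
  have hnb : Icc a b ∈ 𝓝 t := Icc_mem_nhds hat htb
  have h1 : HasDerivAt (fun x => ∫ s in a..x, -(pnu s) / s) (-(pnu t) / t) t :=
    intervalIntegral.integral_hasDerivAt_right
      ((cF.mono (Icc_subset_Icc_right htb.le)).intervalIntegrable_of_Icc hat.le)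
      (ContinuousOn.stronglyMeasurableAtFilter_nhdsWithin cF measurableSet_Icc t |>.filter_mono
        (by rw [nhdsWithin_eq_nhds.2 hnb]))
      (cF.continuousAt hnb)
  refine (h1.const_add (qnu a)).congr_of_eventuallyEq ?_
  filter_upwards [hnb] with x hx using eQ x hx

theorem stmt4 (lam : ℝ) (I : Set ℝ) (hI : ∃ a b : ℝ, I = Set.Ioo a b)
    (q p qt qnu : ℝ → ℝ → ℝ)
    -- Hamiltonian system in t, for each ν ∈ I
    (hqt : ∀ ν ∈ I, ∀ t > (0:ℝ), HasDerivAt (fun t' => q t' ν) (qt t ν) t)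
    (hqt' : ∀ ν ∈ I, ∀ t > (0:ℝ), qt t ν = -(p t ν) / t)
    (hp : ∀ ν ∈ I, ∀ t > (0:ℝ), HasDerivAt (fun t' => p t' ν)
      (-(t/2) * Real.sinh (2 * q t ν) - 2 * ν * Real.sinh (q t ν)) t)
    -- absolute integrability of H, sinh²(q/2) and p·∂q/∂s − H on (t,∞)
    (hHint : ∀ t > (0:ℝ), ∀ ν ∈ I,
      MeasureTheory.IntegrableOn (fun s => Ham2 q p s ν) (Set.Ioi t))
    (hsint : ∀ t > (0:ℝ), ∀ ν ∈ I,
      MeasureTheory.IntegrableOn (fun s => Real.sinh (q s ν / 2) ^ 2) (Set.Ioi t))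
    (hSint : ∀ t > (0:ℝ), ∀ ν ∈ I,
      MeasureTheory.IntegrableOn (fun s => p s ν * qt s ν - Ham2 q p s ν) (Set.Ioi t))
    -- decay at t = +∞
    (hlimH : ∀ ν ∈ I, Filter.Tendsto (fun t => t * Ham2 q p t ν) Filter.atTop (nhds 0))
    (hdecay : ∀ ν ∈ I, Filter.Tendsto (fun s => p s ν * qnu s ν) Filter.atTop (nhds 0))
    -- ν-differentiability with equal mixed partials of q
    (hqnu : ∀ t > (0:ℝ), ∀ ν ∈ I, HasDerivAt (fun ν' => q t ν') (qnu t ν) ν)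
    (hpnu : ∀ t > (0:ℝ), ∀ ν ∈ I, DifferentiableAt ℝ (fun ν' => p t ν') ν)
    (hmix : ∀ t > (0:ℝ), ∀ ν ∈ I,
      HasDerivAt (fun ν' => qt t ν') (deriv (fun t' => qnu t' ν) t) ν)
    -- differentiation of S under the integral sign
    (hleib : ∀ t > (0:ℝ), ∀ ν ∈ I,
      HasDerivAt (fun ν' => ∫ s in Set.Ioi t, (p s ν' * qt s ν' - Ham2 q p s ν'))
        (∫ s in Set.Ioi t, deriv (fun ν' => p s ν' * qt s ν' - Ham2 q p s ν') ν) ν) :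
    ∀ t > (0:ℝ), ∀ ν ∈ I,
      Real.exp ((1/2) * (∫ s in Set.Ioi t, Ham2 q p s ν)
          - ν * ∫ s in Set.Ioi t, Real.sinh (q s ν / 2) ^ 2) * Real.cosh (q t ν / 2)
        = Real.exp (-(t/2) * Ham2 q p t ν
            + (1/2) * (∫ s in Set.Ioi t, (p s ν * qt s ν - Ham2 q p s ν))
            - ν/4 * (p t ν * qnu t ν
              + deriv (fun ν' => ∫ s in Set.Ioi t, (p s ν' * qt s ν' - Ham2 q p s ν')) ν))
          * Real.cosh (q t ν / 2) := by
  intro t ht ν hν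
  have hIopen : IsOpen I := by
    obtain ⟨a, b, rfl⟩ := hI
    exact isOpen_Ioo
  have hIn : ∀ᶠ ν' in 𝓝 ν, ν' ∈ I := hIopen.mem_nhds hν
  have hsolI : ∀ ν' ∈ I, SolODE (fun t => q t ν') (fun t => p t ν') ν' := by
    intro ν' h' s hs
    refine ⟨?_, hp ν' h' s hs⟩
    rw [← hqt' ν' h' s hs]
    exact hqt ν' h' s hs
  have hsol : ∀ᶠ ν' in 𝓝 ν, SolODE (fun t => q t ν') (fun t => p t ν') ν' :=
    hIn.mono hsolI
  set pnu : ℝ → ℝ := fun s => deriv (fun ν' => p s ν') ν with hpnu_def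
  have hpd : ∀ s > (0:ℝ), HasDerivAt (fun ν' => p s ν') (pnu s) ν := fun s hs =>
    (hpnu s hs ν hν).hasDerivAt
  have hqd : ∀ s > (0:ℝ), HasDerivAt (fun ν' => q s ν') (qnu s ν) ν := fun s hs => hqnu s hs ν hν
  have hqnut := qnu_hasDerivAt (qnu := fun s => qnu s ν) hsol hqd hpd
  set sh : ℝ → ℝ := fun s => Real.sinh (q s ν / 2) ^ 2 with hsh
  -- the product p * q_ν and its time derivative
  set W : ℝ → ℝ := fun s => p s ν * qnu s ν with hW
  set W' : ℝ → ℝ := fun s => (-(s/2) * Real.sinh (2 * q s ν) - 2 * ν * Real.sinh (q s ν)) * qnu s ν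
    + p s ν * (-(pnu s) / s) with hW'
  have hWd : ∀ s > (0:ℝ), HasDerivAt W (W' s) s := fun s hs => (hp ν hν s hs).mul (hqnut s hs)
  -- the Lagrangian
  set L : ℝ → ℝ → ℝ := fun s ν' => p s ν' * qt s ν' - Ham2 q p s ν' with hL
  set L2 : ℝ → ℝ → ℝ := fun s ν' => -(1 / (2 * s)) * (p s ν' * p s ν')
    + -(s/2) * (Real.sinh (q s ν') * Real.sinh (q s ν'))
    + -4 * (ν' * (Real.sinh (2⁻¹ * q s ν') * Real.sinh (2⁻¹ * q s ν'))) with hL2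
  have hLL : ∀ ν' ∈ I, ∀ s > (0:ℝ), L s ν' = L2 s ν' := by
    intro ν' h' s hs
    simp only [hL, hL2, Ham2, hqt' ν' h' s hs]
    have e : q s ν' / 2 = 2⁻¹ * q s ν' := by ring
    rw [e]
    field_simp
    ring
  have hL2d : ∀ s > (0:ℝ), HasDerivAt (fun ν' => L2 s ν') (W' s - 4 * sh s) ν := by
    intro s hs
    have dq := hqd s hs
    have dp := hpd s hs
    have dh := (dq.const_mul (2⁻¹ : ℝ)).sinh
    have := (((dp.mul dp).const_mul (-(1 / (2 * s)))).add
      ((dq.sinh.mul dq.sinh).const_mul (-(s/2)))).add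
      (((hasDerivAt_id ν).mul (dh.mul dh)).const_mul (-4))
    refine this.congr_deriv ?_
    have e1 : Real.sinh (q s ν) = 2 * Real.sinh (2⁻¹ * q s ν) * Real.cosh (2⁻¹ * q s ν) := by
      rw [← Real.sinh_two_mul]; congr 1; ring
    have e2 : q s ν / 2 = 2⁻¹ * q s ν := by ring
    simp only [hW', hsh, Real.sinh_two_mul (q s ν), e2, id, Pi.mul_apply, Pi.pow_apply]
    rw [e1]
    field_simp
    ring
  have hLd : ∀ s > (0:ℝ), HasDerivAt (fun ν' => L s ν') (W' s - 4 * sh s) ν := fun s hs =>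
    (hL2d s hs).congr_of_eventuallyEq (hIn.mono fun ν' h' => hLL ν' h' s hs)
  set S : ℝ → ℝ → ℝ := fun t ν' => ∫ s in Ioi t, L s ν' with hS
  set Sν : ℝ → ℝ := fun T => ∫ s in Ioi T, deriv (fun ν' => L s ν') ν with hSν
  have hSd : ∀ T > (0:ℝ), HasDerivAt (fun ν' => S T ν') (Sν T) ν := fun T hT => hleib T hT ν hν
  have hSν2 : ∀ T > (0:ℝ), Sν T = ∫ s in Ioi T, (W' s - 4 * sh s) := by
    intro T hT
    exact setIntegral_congr_fun measurableSet_Ioi fun s hs => (hLd s (hT.trans hs)).deriv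
  -- integrability and differentiation on compact intervals
  have hcomp : ∀ T ≥ t, IntervalIntegrable (fun s => W' s - 4 * sh s) volume t T ∧
      Sν t - Sν T = ∫ s in t..T, (W' s - 4 * sh s) := by
    intro T hT
    have hT0 : 0 < T := ht.trans_le hT
    have hpos : ∀ s ∈ Icc t T, 0 < s := fun s hs => ht.trans_le hs.1
    obtain ⟨Uq, Up⟩ := sol_UL ht hT hsol (hqd t ht).differentiableAt
      (hqd T hT0).differentiableAt (hpd t ht).differentiableAt
    have cinv : ContinuousOn (fun s : ℝ => -(1 / (2 * s))) (Icc t T) := by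
      refine (continuousOn_const.div (by fun_prop) fun s hs => ?_).neg
      have := hpos s hs
      positivity
    have UL2 : UL t T ν L2 :=
      (((UL.time cinv).mul (Up.mul Up)).add
        ((UL.time (f := fun s => -(s/2)) (by fun_prop)).mul (Uq.sinh.mul Uq.sinh))).add
        ((UL.time (f := fun _ => -4) (by fun_prop)).mul (UL.param.mul
          (((UL.time (f := fun _ => 2⁻¹) (by fun_prop)).mul Uq).sinh.mul
          ((UL.time (f := fun _ => 2⁻¹) (by fun_prop)).mul Uq).sinh)))
    have cL2 : ∀ᶠ ν' in 𝓝 ν, ContinuousOn (fun s => L2 s ν') (Icc t T) := by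
      filter_upwards [hsol] with ν' h
      have cq : ContinuousOn (fun s => q s ν') (Icc t T) := fun s hs =>
        (h s (hpos s hs)).1.continuousAt.continuousWithinAt
      have cp : ContinuousOn (fun s => p s ν') (Icc t T) := fun s hs =>
        (h s (hpos s hs)).2.continuousAt.continuousWithinAt
      exact ((cinv.mul (cp.mul cp)).add (by fun_prop)).add (by fun_prop)
    obtain ⟨h1, h2⟩ := UL2.hasDerivAt_integral hT cL2 (fun s hs => hL2d s (hpos s hs))
    refine ⟨h1, ((hSd t ht).sub (hSd T hT0)).unique (h2.congr_of_eventuallyEq ?_)⟩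
    filter_upwards [hIn] with ν' h'
    simp only [hS, Pi.sub_apply]
    rw [intervalIntegral.integral_Ioi_sub_Ioi (hSint t ht ν' h') hT]
    refine intervalIntegral.integral_congr fun s hs => ?_
    rw [uIcc_of_le hT] at hs
    exact hLL ν' h' s (hpos s hs)
  have hshI : IntegrableOn sh (Ioi t) := hsint t ht ν hν
  have hshII : ∀ T ≥ t, IntervalIntegrable sh volume t T := fun T hT =>
    (intervalIntegrable_iff_integrableOn_Ioc_of_le hT).2 (hshI.mono_set Ioc_subset_Ioi_self)
  have hftc : ∀ T ≥ t, Sν t - Sν T = W T - W t - 4 * ∫ s in t..T, sh s := by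
    intro T hT
    obtain ⟨h1, h2⟩ := hcomp T hT
    have hW'I : IntervalIntegrable W' volume t T := by
      have := h1.add ((hshII T hT).const_mul 4)
      refine this.congr (fun s _ => ?_)
      simp
    rw [h2, intervalIntegral.integral_sub hW'I ((hshII T hT).const_mul 4),
      intervalIntegral.integral_const_mul,
      intervalIntegral.integral_eq_sub_of_hasDerivAt (f := W) (fun s hs => ?_) hW'I]
    rw [uIcc_of_le hT] at hs
    exact hWd s (ht.trans_le hs.1)
  have hlim1 : Tendsto Sν atTop (𝓝 0) := by
    by_cases hint : IntegrableOn (fun s => W' s - 4 * sh s) (Ioi t)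
    · have h1 := intervalIntegral_tendsto_integral_Ioi t hint tendsto_id
      have h2 : Tendsto (fun T => Sν t - ∫ s in t..T, (W' s - 4 * sh s)) atTop (𝓝 (Sν t - Sν t)) := by
        refine tendsto_const_nhds.sub ?_
        rw [hSν2 t ht]
        exact h1
      rw [sub_self] at h2
      refine h2.congr' ?_
      filter_upwards [eventually_ge_atTop t] with T hT
      rw [← (hcomp T hT).2]; ring
    · refine tendsto_const_nhds.congr' ?_
      filter_upwards [eventually_ge_atTop t] with T hT
      rw [hSν2 T (ht.trans_le hT)]
      refine (integral_undef fun h => hint ?_).symm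
      rw [← Ioc_union_Ioi_eq_Ioi hT]
      exact ((intervalIntegrable_iff_integrableOn_Ioc_of_le hT).1 (hcomp T hT).1).union h
  have hkey : W t + Sν t = -4 * ∫ s in Ioi t, sh s := by
    have h1 : Tendsto (fun T => W T - W t - 4 * ∫ s in t..T, sh s) atTop
        (𝓝 (0 - W t - 4 * ∫ s in Ioi t, sh s)) :=
      ((hdecay ν hν).sub_const _).sub
        ((intervalIntegral_tendsto_integral_Ioi t hshI tendsto_id).const_mul 4)
    have h2 : Tendsto (fun T => Sν t - Sν T) atTop (𝓝 (Sν t - 0)) := hlim1.const_sub _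
    have h3 := tendsto_nhds_unique (h2.congr' (by
      filter_upwards [eventually_ge_atTop t] with T hT using hftc T hT)) h1
    linarith
  -- the total derivative of t * H
  have hHd : ∀ s ∈ Ici t, HasDerivAt (fun s => s * Ham2 q p s ν)
      (Ham2 q p s ν - L s ν - 4 * ν * sh s) s := by
    intro s hs
    have hs0 : 0 < s := ht.trans_le hs
    obtain ⟨dq, dp⟩ := hsolI ν hν s hs0
    have e : ∀ s ∈ Ioi (0:ℝ), s * Ham2 q p s ν = 2⁻¹ * (s * Real.sinh (q s ν)) ^ 2
        - 2⁻¹ * (p s ν) ^ 2 + 4 * ν * (s * Real.sinh (2⁻¹ * q s ν) ^ 2) := by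
      intro s hs
      have hs0 : s ≠ 0 := (mem_Ioi.1 hs).ne'
      have e : q s ν / 2 = 2⁻¹ * q s ν := by ring
      simp only [Ham2, e]
      field_simp
    have := (((((hasDerivAt_id s).mul dq.sinh).pow 2).const_mul (2⁻¹ : ℝ)).sub
      ((dp.pow 2).const_mul (2⁻¹ : ℝ))).add
      (((hasDerivAt_id s).mul ((dq.const_mul (2⁻¹ : ℝ)).sinh.pow 2)).const_mul (4 * ν))
    refine (this.congr_deriv ?_).congr_of_eventuallyEq
      (by filter_upwards [Ioi_mem_nhds hs0] with x hx using e x hx)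
    rw [hLL ν hν s hs0]
    have e1 : Real.sinh (q s ν) = 2 * Real.sinh (2⁻¹ * q s ν) * Real.cosh (2⁻¹ * q s ν) := by
      rw [← Real.sinh_two_mul]; congr 1; ring
    have e2 : q s ν / 2 = 2⁻¹ * q s ν := by ring
    simp only [hL2, hsh, Ham2, Real.sinh_two_mul (q s ν), e2, id, Pi.mul_apply, Pi.pow_apply]
    rw [e1]
    field_simp
    ring
  have hHI := hHint t ht ν hν
  have hLI : IntegrableOn (fun s => L s ν) (Ioi t) := hSint t ht ν hν
  have hH := integral_Ioi_of_hasDerivAt_of_tendsto' hHd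
    ((hHI.sub hLI).sub (hshI.const_mul (4 * ν))) (hlimH ν hν)
  have hHL : IntegrableOn (fun s => Ham2 q p s ν - L s ν) (Ioi t) := hHI.sub hLI
  rw [integral_sub hHL (hshI.const_mul (4 * ν)), integral_sub hHI hLI,
    integral_const_mul] at hH
  have hder : deriv (fun ν' => ∫ s in Set.Ioi t, (p s ν' * qt s ν' - Ham2 q p s ν')) ν = Sν t :=
    (hSd t ht).deriv
  have hkey2 : p t ν * qnu t ν + Sν t = -4 * ∫ s in Ioi t, sh s := hkey
  have hSt : ∫ s in Set.Ioi t, (p s ν * qt s ν - Ham2 q p s ν) = ∫ s in Ioi t, L s ν := rfl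
  rw [hder, hkey2, hSt]
  congr 2
  linarith
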